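/- Suppose F ∈ 𝓕₁(I) satisfies hypothesis (H), so that K = (a,c₁) is the unique absorbing interval of F. Then every strictly increasing iterative root of F of order n in 𝓕(I) is, on I ∖ J(F), uniquely determined by its restriction to K: if f, g ∈ 𝓕(I) are strictly increasing iterative roots of F of the same order n with f(x) = g(x) for all x ∈ K, then f(x) = g(x) for all x ∈ I ∖ J(F). -/

import Mathlib

open Set Filter Topology

/-- Iterates of a multifunction: `Iter F 0 x = {x}`, `Iter F (n+1) x = F (Iter F n x)`. -/
def Iter (F : ℝ → Set ℝ) : ℕ → ℝ → Set ℝ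
  | 0 => fun x => {x}
  | n + 1 => fun x => ⋃ y ∈ Iter F n x, F y

/-- Composition of multifunctions: `(G ∘ F)(x) = ⋃ y ∈ F x, G y`. -/
def Comp (G F : ℝ → Set ℝ) : ℝ → Set ℝ := fun x => ⋃ y ∈ F x, G y

/-- Image of a set under a multifunction: `F(A) = ⋃ x ∈ A, F x`. -/
def ImageOf (F : ℝ → Set ℝ) (A : Set ℝ) : Set ℝ := ⋃ x ∈ A, F x

/-- `F` is a multifunction on `[a,b]`: nonempty compact values contained in `[a,b]`. -/
def MFOn (a b : ℝ) (F : ℝ → Set ℝ) : Prop :=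
  ∀ x ∈ Icc a b, (F x).Nonempty ∧ IsCompact (F x) ∧ F x ⊆ Icc a b

/-- Upper semicontinuity of a multifunction at a point, relative to a domain `S`. -/
def USCWithin (S : Set ℝ) (F : ℝ → Set ℝ) (x : ℝ) : Prop :=
  ∀ V : Set ℝ, IsOpen V → F x ⊆ V → ∃ U ∈ 𝓝 x, ∀ y ∈ U ∩ S, F y ⊆ V

/-- Upper semicontinuity on `[a,b]`. -/
def USCOn (a b : ℝ) (F : ℝ → Set ℝ) : Prop :=
  ∀ x ∈ Icc a b, USCWithin (Icc a b) F x

/-- Strictly increasing multifunction: `max F(x) < min F(y)` whenever `x < y` in `[a,b]`. -/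
def SIncOn (a b : ℝ) (F : ℝ → Set ℝ) : Prop :=
  ∀ x ∈ Icc a b, ∀ y ∈ Icc a b, x < y → ∀ u ∈ F x, ∀ v ∈ F y, u < v

/-- Strictly decreasing multifunction: `min F(x) > max F(y)` whenever `x < y` in `[a,b]`. -/
def SDecOn (a b : ℝ) (F : ℝ → Set ℝ) : Prop :=
  ∀ x ∈ Icc a b, ∀ y ∈ Icc a b, x < y → ∀ u ∈ F x, ∀ v ∈ F y, v < u

/-- The class 𝓕(I) of strictly monotone usc multifunctions on `I = [a,b]`. -/
def ClassF (a b : ℝ) (F : ℝ → Set ℝ) : Prop :=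
  MFOn a b F ∧ USCOn a b F ∧ (SIncOn a b F ∨ SDecOn a b F)

/-- The set `J(F)` of jumps (set-valued points) of `F` in `[a,b]`. -/
def Jumps (a b : ℝ) (F : ℝ → Set ℝ) : Set ℝ :=
  {x | x ∈ Icc a b ∧ (F x).Nontrivial}

/-- `k` is the intensity `ζ(F)`: the least `k` with `#J(F^k) = #J(F^{k+1})`. -/
def IsIntensity (a b : ℝ) (F : ℝ → Set ℝ) (k : ℕ) : Prop :=
  IsLeast {j : ℕ | (Jumps a b (Iter F j)).ncard = (Jumps a b (Iter F (j + 1))).ncard} k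

/-- Exclusive multifunctions 𝓕₁(I): members of 𝓕(I) with finitely many jumps and intensity 1. -/
def Exclusive (a b : ℝ) (F : ℝ → Set ℝ) : Prop :=
  ClassF a b F ∧ (Jumps a b F).Finite ∧ IsIntensity a b F 1

/-- Enumeration of the jumps: `c 0 = a`, `c (m+1) = b`, `c` strictly increasing on `{0,…,m+1}`,
and the jumps of `F` are exactly `c 1 < … < c m`.  The subintervals are `I_i = (c i, c (i+1))`. -/
def JumpEnum (a b : ℝ) (F : ℝ → Set ℝ) (m : ℕ) (c : ℕ → ℝ) : Prop :=
  c 0 = a ∧ c (m + 1) = b ∧ (∀ i j : ℕ, i < j → j ≤ m + 1 → c i < c j) ∧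
    Jumps a b F = {x | ∃ i : ℕ, 1 ≤ i ∧ i ≤ m ∧ x = c i}

/-- Hypothesis (H): `F` is strictly increasing, `max F(x) < x` on `(a,b)`, and `max F(b) ≤ b`. -/
def HypH (a b : ℝ) (F : ℝ → Set ℝ) : Prop :=
  SIncOn a b F ∧ (∀ x ∈ Ioo a b, ∀ u ∈ F x, u < x) ∧ (∀ u ∈ F b, u ≤ b)

theorem iter_succ_eq_biUnion (f : ℝ → Set ℝ) (k : ℕ) (x : ℝ) :
    Iter f (k + 1) x = ⋃ y ∈ f x, Iter f k y := by
  induction k with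
  | zero => ext z; simp [Iter]
  | succ k ih =>
    change (⋃ y ∈ Iter f (k + 1) x, f y) = ⋃ y ∈ f x, ⋃ w ∈ Iter f k y, f w
    rw [ih]
    ext z
    simp only [mem_iUnion, exists_prop]
    grind

theorem iter_add_eq_biUnion (f : ℝ → Set ℝ) (k l : ℕ) (x : ℝ) :
    Iter f (k + l) x = ⋃ y ∈ Iter f k x, Iter f l y := by
  induction l with
  | zero => ext z; simp [Iter]
  | succ l ih =>
    change (⋃ y ∈ Iter f (k + l) x, f y) = ⋃ y ∈ Iter f k x, ⋃ w ∈ Iter f l y, f w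
    rw [ih]
    ext z
    simp only [mem_iUnion, exists_prop]
    grind

theorem mem_iter_succ {f : ℝ → Set ℝ} {k : ℕ} {x y z : ℝ} (hy : y ∈ Iter f k x) (hz : z ∈ f y) :
    z ∈ Iter f (k + 1) x := by
  simpa only [Iter, mem_iUnion, exists_prop] using ⟨y, hy, hz⟩

section

variable {a b : ℝ} {f : ℝ → Set ℝ}

theorem iter_subset_Icc (hM : MFOn a b f) (k : ℕ) {x : ℝ} (hx : x ∈ Icc a b) :
    Iter f k x ⊆ Icc a b := by
  induction k with
  | zero => simpa [Iter] using hx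
  | succ k ih => exact iUnion₂_subset fun y hy => (hM y (ih hy)).2.2

theorem iter_nonempty (hM : MFOn a b f) (k : ℕ) {x : ℝ} (hx : x ∈ Icc a b) :
    (Iter f k x).Nonempty := by
  induction k with
  | zero => simp [Iter]
  | succ k ih =>
    obtain ⟨y, hy⟩ := ih
    obtain ⟨z, hz⟩ := (hM y (iter_subset_Icc hM k hx hy)).1
    exact ⟨z, mem_iter_succ hy hz⟩

theorem SIncOn.iter (hI : SIncOn a b f) (hM : MFOn a b f) (k : ℕ) : SIncOn a b (Iter f k) := by
  induction k with
  | zero =>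
    intro x _ y _ hxy u hu v hv
    rw [mem_singleton_iff.1 hu, mem_singleton_iff.1 hv]
    exact hxy
  | succ k ih =>
    intro x hx y hy hxy u hu v hv
    simp only [Iter, mem_iUnion, exists_prop] at hu hv
    obtain ⟨u', hu', hu⟩ := hu
    obtain ⟨v', hv', hv⟩ := hv
    exact hI u' (iter_subset_Icc hM k hx hu') v' (iter_subset_Icc hM k hy hv')
      (ih x hx y hy hxy u' hu' v' hv') u hu v hv

theorem exists_mem_iter_ge (hI : SIncOn a b f) (hM : MFOn a b f) {x u : ℝ} (hx : x ∈ Icc a b)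
    (hu : u ∈ f x) (hxu : x ≤ u) {k : ℕ} (hk : 1 ≤ k) : ∃ v ∈ Iter f k x, u ≤ v := by
  induction k, hk using Nat.le_induction with
  | base => exact ⟨u, by simpa [Iter] using hu, le_rfl⟩
  | succ k _ ih =>
    obtain ⟨v, hv, huv⟩ := ih
    have hvI := iter_subset_Icc hM k hx hv
    rcases (hxu.trans huv).eq_or_lt with rfl | hlt
    · exact ⟨u, mem_iter_succ hv hu, le_rfl⟩
    · obtain ⟨w, hw⟩ := (hM v hvI).1
      exact ⟨w, mem_iter_succ hv hw, (hI x hx v hvI hlt u hu w hw).le⟩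

theorem exists_mem_iter_le (hI : SIncOn a b f) (hM : MFOn a b f) {x u : ℝ} (hx : x ∈ Icc a b)
    (hu : u ∈ f x) (hux : u ≤ x) {k : ℕ} (hk : 1 ≤ k) : ∃ v ∈ Iter f k x, v ≤ u := by
  induction k, hk using Nat.le_induction with
  | base => exact ⟨u, by simpa [Iter] using hu, le_rfl⟩
  | succ k _ ih =>
    obtain ⟨v, hv, hvu⟩ := ih
    have hvI := iter_subset_Icc hM k hx hv
    rcases (hvu.trans hux).eq_or_lt with rfl | hlt
    · exact ⟨u, mem_iter_succ hv hu, le_rfl⟩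
    · obtain ⟨w, hw⟩ := (hM v hvI).1
      exact ⟨w, mem_iter_succ hv hw, (hI v hvI x hx hlt w hw u hu).le⟩

theorem jumps_iter_mono (hI : SIncOn a b f) (hM : MFOn a b f) :
    Monotone fun k => Jumps a b (Iter f k) := by
  refine monotone_nat_of_le_succ fun k x hx => ⟨hx.1, ?_⟩
  obtain ⟨u, hu, v, hv, huv⟩ := hx.2.exists_lt
  have huI := iter_subset_Icc hM k hx.1 hu
  have hvI := iter_subset_Icc hM k hx.1 hv
  obtain ⟨u', hu'⟩ := (hM u huI).1
  obtain ⟨v', hv'⟩ := (hM v hvI).1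
  exact ⟨u', mem_iter_succ hu hu', v', mem_iter_succ hv hv',
    (hI u huI v hvI huv u' hu' v' hv').ne⟩

theorem iter_one (F : ℝ → Set ℝ) : Iter F 1 = F := by
  funext x
  simp [Iter]

theorem jumps_iter_zero (F : ℝ → Set ℝ) : Jumps a b (Iter F 0) = ∅ := by
  ext x
  simp [Jumps, Iter]

theorem Exclusive.jumps_iter_two {F : ℝ → Set ℝ} (hF : Exclusive a b F) (hI : SIncOn a b F) :
    Jumps a b (Iter F 2) = Jumps a b F := by
  obtain ⟨⟨hM, -, -⟩, -, hmem, hleast⟩ := hF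
  have hcard : (Jumps a b F).ncard = (Jumps a b (Iter F 2)).ncard := by
    simpa [iter_one] using hmem
  have hne : (Jumps a b F).ncard ≠ 0 := fun h =>
    absurd (hleast (show (Jumps a b (Iter F 0)).ncard = (Jumps a b (Iter F (0 + 1))).ncard by
      rw [jumps_iter_zero, zero_add, iter_one, h, ncard_empty])) (by norm_num)
  have hsub : Jumps a b F ⊆ Jumps a b (Iter F 2) := by
    simpa [iter_one] using jumps_iter_mono hI hM (show 1 ≤ 2 by norm_num)
  exact (eq_of_subset_of_ncard_le hsub hcard.ge (finite_of_ncard_ne_zero (hcard ▸ hne))).symm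

variable {F : ℝ → Set ℝ} {n : ℕ}

theorem jumps_congr {G : ℝ → Set ℝ} (h : ∀ x ∈ Icc a b, G x = F x) :
    Jumps a b G = Jumps a b F := by
  ext x
  refine and_congr_right fun hx => ?_
  rw [h x hx]

/-- Off the jumps of an exclusive multifunction, a root is single valued and avoids the jumps. -/
theorem root_eq_singleton (hF : Exclusive a b F) (hFI : SIncOn a b F) (hM : MFOn a b f)
    (hI : SIncOn a b f) (hn : 1 ≤ n) (hroot : ∀ x ∈ Icc a b, Iter f n x = F x) {x : ℝ}
    (hx : x ∈ Icc a b \ Jumps a b F) : ∃ y ∈ Icc a b \ Jumps a b F, f x = {y} := by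
  have hJ : Jumps a b (Iter f n) = Jumps a b F := jumps_congr hroot
  have hJJ : Jumps a b (Iter f (n + n)) = Jumps a b F := by
    rw [← hF.jumps_iter_two hFI]
    refine jumps_congr fun z hz => ?_
    rw [iter_add_eq_biUnion, hroot z hz, show (2 : ℕ) = 1 + 1 from rfl, iter_succ_eq_biUnion,
      iter_one]
    exact iUnion₂_congr fun y hy => hroot y ((hF.1.1 z hz).2.2 hy)
  have hmono := jumps_iter_mono hI hM
  obtain ⟨y, hy⟩ := (hM x hx.1).1
  refine ⟨y, ⟨(hM x hx.1).2.2 hy, fun hyJ => hx.2 ?_⟩, ?_⟩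
  · rw [← hJJ]
    refine hmono (show n + 1 ≤ n + n by omega) ⟨hx.1, ?_⟩
    rw [iter_succ_eq_biUnion]
    exact ((hJ.symm ▸ hyJ : y ∈ Jumps a b (Iter f n)).2).mono (subset_biUnion_of_mem hy)
  · have hsub : (f x).Subsingleton := by
      rw [← not_nontrivial_iff]
      intro hnt
      refine hx.2 (hJ ▸ hmono hn ⟨hx.1, ?_⟩)
      rwa [iter_one]
    exact hsub.eq_singleton_of_mem hy

theorem HypH.image_left_le (hH : HypH a b F) (hab : a < b) (hM : MFOn a b F) :
    ∀ u ∈ F a, u ≤ a := by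
  intro u hu
  refine le_of_forall_gt_imp_ge_of_dense fun x hx => ?_
  rcases lt_or_ge x b with hxb | hxb
  · obtain ⟨v, hv⟩ := (hM x ⟨hx.le, hxb.le⟩).1
    exact ((hH.1 a ⟨le_rfl, hab.le⟩ x ⟨hx.le, hxb.le⟩ hx u hu v hv).trans
      (hH.2.1 x ⟨hx, hxb⟩ v hv)).le
  · exact ((hM a ⟨le_rfl, hab.le⟩).2.2 hu).2.trans hxb

theorem root_lt_self (hH : HypH a b F) (hM : MFOn a b f) (hI : SIncOn a b f) (hn : 1 ≤ n)
    (hroot : ∀ x ∈ Icc a b, Iter f n x = F x) {x u : ℝ} (hx : x ∈ Ioo a b) (hu : u ∈ f x) :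
    u < x := by
  by_contra! h
  obtain ⟨v, hv, huv⟩ := exists_mem_iter_ge hI hM (Ioo_subset_Icc_self hx) hu h hn
  rw [hroot x (Ioo_subset_Icc_self hx)] at hv
  exact (hH.2.1 x hx v hv).not_ge (h.trans huv)

theorem root_left (hab : a < b) (hH : HypH a b F) (hFM : MFOn a b F) (hM : MFOn a b f)
    (hI : SIncOn a b f) (hn : 1 ≤ n) (hroot : ∀ x ∈ Icc a b, Iter f n x = F x) :
    f a = {a} := by
  have ha : a ∈ Icc a b := ⟨le_rfl, hab.le⟩
  refine eq_singleton_iff_nonempty_unique_mem.2 ⟨(hM a ha).1, fun u hu => ?_⟩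
  have hau := ((hM a ha).2.2 hu).1
  obtain ⟨v, hv, huv⟩ := exists_mem_iter_ge hI hM ha hu hau hn
  rw [hroot a ha] at hv
  exact le_antisymm (huv.trans (hH.image_left_le hab hFM v hv)) hau

theorem root_le_self (hab : a < b) (hH : HypH a b F) (hFM : MFOn a b F) (hM : MFOn a b f)
    (hI : SIncOn a b f) (hn : 1 ≤ n) (hroot : ∀ x ∈ Icc a b, Iter f n x = F x) {x u : ℝ}
    (hx : x ∈ Icc a b) (hu : u ∈ f x) : u ≤ x := by
  rcases hx.1.eq_or_lt with rfl | hax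
  · rw [root_left hab hH hFM hM hI hn hroot] at hu
    exact hu.le
  · rcases hx.2.eq_or_lt with rfl | hxb
    · exact ((hM x hx).2.2 hu).2
    · exact (root_lt_self hH hM hI hn hroot ⟨hax, hxb⟩ hu).le

theorem root_right_eq (hab : a < b) (hM : MFOn a b f) (hI : SIncOn a b f) (hn : 1 ≤ n)
    (hroot : ∀ x ∈ Icc a b, Iter f n x = F x) (hsub : (F b).Subsingleton) {p : ℝ}
    (hp : p ∈ f b) : p = b ↔ b ∈ F b := by
  have hb : b ∈ Icc a b := ⟨hab.le, le_rfl⟩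
  have hpb := ((hM b hb).2.2 hp).2
  constructor
  · rintro rfl
    obtain ⟨v, hv, hbv⟩ := exists_mem_iter_ge hI hM hb hp le_rfl hn
    have hvb := (iter_subset_Icc hM n hb hv).2
    rwa [le_antisymm hvb hbv, hroot p hb] at hv
  · intro hbF
    obtain ⟨v, hv, hvp⟩ := exists_mem_iter_le hI hM hb hp hpb hn
    rw [hroot b hb] at hv
    rw [hsub hv hbF] at hvp
    exact le_antisymm hpb hvp

theorem iter_congr_of_invariant {g : ℝ → Set ℝ} {N : Set ℝ} (hN : ∀ z ∈ N, f z ⊆ N)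
    (heq : ∀ z ∈ N, f z = g z) (k : ℕ) {z : ℝ} (hz : z ∈ N) : Iter f k z = Iter g k z := by
  induction k generalizing z with
  | zero => rfl
  | succ k ih =>
    rw [iter_succ_eq_biUnion, iter_succ_eq_biUnion, ← heq z hz]
    exact iUnion₂_congr fun y hy => ih (hN z hz hy)

theorem eq_of_iter_eq (hM : MFOn a b f) (hI : SIncOn a b f) {k : ℕ} {p q : ℝ}
    (hp : p ∈ Icc a b) (hq : q ∈ Icc a b) (h : Iter f k p = Iter f k q) : p = q := by
  obtain ⟨u, hu⟩ := iter_nonempty hM k hp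
  by_contra hne
  rcases lt_or_gt_of_ne hne with hlt | hlt
  · exact (hI.iter hM k p hp q hq hlt u hu u (h ▸ hu)).false
  · exact (hI.iter hM k q hq p hp hlt u (h ▸ hu) u hu).false

theorem USCOn.exists_lt_of_image_lt (hU : USCOn a b f) {s : ℝ} (hs : s ∈ Icc a b)
    (hlt : ∀ u ∈ f s, u < s) : ∃ t > s, ∀ z ∈ Ico s t, z ∈ Icc a b → ∀ u ∈ f z, u < s := by
  obtain ⟨U, hUs, hU⟩ := hU s hs (Iio s) isOpen_Iio hlt
  obtain ⟨t, hst, ht⟩ := exists_Ico_subset_of_mem_nhds hUs (exists_gt s)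
  exact ⟨t, hst, fun z hz hzI u hu => hU z ⟨ht hz, hzI⟩ hu⟩

end

/-- under hypothesis (H), a strictly increasing iterative root of `F` of order
`n` in 𝓕(I) is uniquely determined on `I ∖ J(F)` by its restriction to the absorbing
interval `K = (a, c₁)`. -/
theorem stmt11 (a b : ℝ) (hab : a < b) (F : ℝ → Set ℝ) (hF : Exclusive a b F)
    (hH : HypH a b F) (m : ℕ) (c : ℕ → ℝ) (hc : JumpEnum a b F m c)
    (f g : ℝ → Set ℝ) (hf : ClassF a b f) (hg : ClassF a b g)
    (hfinc : SIncOn a b f) (hginc : SIncOn a b g)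
    (n : ℕ) (hn : 1 ≤ n)
    (hfroot : ∀ x ∈ Icc a b, Iter f n x = F x)
    (hgroot : ∀ x ∈ Icc a b, Iter g n x = F x)
    (heq : ∀ x ∈ Ioo a (c 1), f x = g x) :
    ∀ x ∈ Icc a b \ Jumps a b F, f x = g x := by
  have hFM := hF.1.1
  have hfs := fun x => root_eq_singleton (x := x) hF hH.1 hf.1 hfinc hn hfroot
  have hgs := fun x => root_eq_singleton (x := x) hF hH.1 hg.1 hginc hn hgroot
  have step : ∀ t, (∀ z ∈ Icc a b \ Jumps a b F, z < t → f z = g z) →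
      ∀ x ∈ Icc a b \ Jumps a b F, (∀ u ∈ f x, u < t) → (∀ u ∈ g x, u < t) → f x = g x := by
    intro t ht x hx hft hgt
    obtain ⟨p, hp, hfp⟩ := hfs x hx
    obtain ⟨q, hq, hgq⟩ := hgs x hx
    have hinv : ∀ z ∈ (Icc a b \ Jumps a b F) ∩ Iio t, f z ⊆ (Icc a b \ Jumps a b F) ∩ Iio t := by
      intro z hz u hu
      obtain ⟨y, hy, hfy⟩ := hfs z hz.1
      obtain rfl : u = y := by simpa [hfy] using hu
      exact ⟨hy, (root_le_self hab hH hFM hf.1 hfinc hn hfroot hz.1.1 hu).trans_lt hz.2⟩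
    obtain ⟨k, rfl⟩ := Nat.exists_eq_add_of_le' hn
    have hqt : q < t := hgt q (by simp [hgq])
    have hiter : Iter f k p = Iter f k q := by
      rw [iter_congr_of_invariant hinv (fun z hz => ht z hz.1 hz.2) k ⟨hq, hqt⟩]
      have := (hfroot x hx.1).trans (hgroot x hx.1).symm
      simpa [iter_succ_eq_biUnion, hfp, hgq] using this
    rw [hfp, hgq, eq_of_iter_eq hf.1 hfinc hp.1 hq.1 hiter]
  let S := {t | t ∈ Icc a b ∧ ∀ z ∈ Icc a b \ Jumps a b F, z < t → f z = g z}
  have hac : a < c 1 := hc.1 ▸ hc.2.2.1 0 1 one_pos (by omega)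
  have hcb : c 1 ≤ b := by
    rw [← hc.2.1]
    rcases (show 1 ≤ m + 1 by omega).eq_or_lt with h | h
    · rw [← h]
    · exact (hc.2.2.1 1 (m + 1) h le_rfl).le
  have hcS : c 1 ∈ S := by
    refine ⟨⟨hac.le, hcb⟩, fun z hz hzc => ?_⟩
    rcases hz.1.1.eq_or_lt with rfl | haz
    · rw [root_left hab hH hFM hf.1 hfinc hn hfroot, root_left hab hH hFM hg.1 hginc hn hgroot]
    · exact heq z ⟨haz, hzc⟩
  have hbdd : BddAbove S := ⟨b, fun t ht => ht.1.2⟩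
  have hsb : sSup S ≤ b := csSup_le ⟨_, hcS⟩ fun t ht => ht.1.2
  have has : a < sSup S := hac.trans_le (le_csSup hbdd hcS)
  have hbelow : ∀ z ∈ Icc a b \ Jumps a b F, z < sSup S → f z = g z := by
    intro z hz hzs
    obtain ⟨t, ht, hzt⟩ := exists_lt_of_lt_csSup ⟨_, hcS⟩ hzs
    exact ht.2 z hz hzt
  have hsup : sSup S = b := by
    by_contra hne
    have hs : sSup S ∈ Ioo a b := ⟨has, lt_of_le_of_ne hsb hne⟩
    obtain ⟨t₁, hst₁, h₁⟩ := hf.2.1.exists_lt_of_image_lt (Ioo_subset_Icc_self hs)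
      fun u hu => root_lt_self hH hf.1 hfinc hn hfroot hs hu
    obtain ⟨t₂, hst₂, h₂⟩ := hg.2.1.exists_lt_of_image_lt (Ioo_subset_Icc_self hs)
      fun u hu => root_lt_self hH hg.1 hginc hn hgroot hs hu
    have hst : sSup S < min b (min t₁ t₂) := lt_min hs.2 (lt_min hst₁ hst₂)
    refine (le_csSup hbdd (show min b (min t₁ t₂) ∈ S from
      ⟨⟨(has.trans hst).le, min_le_left _ _⟩, fun z hz hzt => ?_⟩)).not_gt hst
    rcases lt_or_ge z (sSup S) with hzs | hzs
    · exact hbelow z hz hzs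
    · obtain ⟨-, hz₁, hz₂⟩ : z < b ∧ z < t₁ ∧ z < t₂ := by simpa using hzt
      exact step _ hbelow z hz (h₁ z ⟨hzs, hz₁⟩ hz.1) (h₂ z ⟨hzs, hz₂⟩ hz.1)
  rw [hsup] at hbelow
  intro x hx
  rcases hx.1.2.lt_or_eq with hxb | rfl
  · exact hbelow x hx hxb
  · have hsub : (F x).Subsingleton := not_nontrivial_iff.1 fun h => hx.2 ⟨hx.1, h⟩
    have hfx := fun p hp => root_right_eq (p := p) hab hf.1 hfinc hn hfroot hsub hp
    have hgx := fun p hp => root_right_eq (p := p) hab hg.1 hginc hn hgroot hsub hp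
    by_cases hxF : x ∈ F x
    · rw [eq_singleton_iff_nonempty_unique_mem.2 ⟨(hf.1 x hx.1).1, fun p hp => (hfx p hp).2 hxF⟩,
        eq_singleton_iff_nonempty_unique_mem.2 ⟨(hg.1 x hx.1).1, fun p hp => (hgx p hp).2 hxF⟩]
    · exact step x hbelow x hx
        (fun p hp => lt_of_le_of_ne ((hf.1 x hx.1).2.2 hp).2 fun h => hxF ((hfx p hp).1 h))
        (fun p hp => lt_of_le_of_ne ((hg.1 x hx.1).2.2 hp).2 fun h => hxF ((hgx p hp).1 h))
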